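/- Let T be a 3-interval exchange transformation with permutation (321) exchanging intervals of lengths λ_1, λ_2, λ_3. Then T is minimal if and only if (λ_1 − λ_3)/(1 − λ_3) is irrational. -/

import Mathlib

open Set

namespace IETRoots

noncomputable section

/-- The unit interval `[0,1)`, the domain of our interval exchange transformations. -/
def unitI : Set ℝ := Set.Ico 0 1

/-- `T : ℝ → ℝ` is (the extension by the identity of) an interval exchange
transformation: it fixes the complement of `[0,1)`, maps `[0,1)` bijectively onto
itself, and there is a finite partition of `[0,1)` into half-open intervals on each
of which `T` is a translation.  The group `𝔾` of IETs is the set of such maps under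
composition. -/
def IsIET (T : ℝ → ℝ) : Prop :=
  Set.BijOn T unitI unitI ∧ (∀ x, x ∉ unitI → T x = x) ∧
  ∃ (k : ℕ) (β : Fin (k + 1) → ℝ), StrictMono β ∧ β 0 = 0 ∧ β (Fin.last k) = 1 ∧
    ∀ i : Fin k, ∃ c : ℝ, ∀ x ∈ Set.Ico (β i.castSucc) (β i.succ), T x = x + c

/-- The `ℤ`-orbit `{T^n x : n ∈ ℤ}` of `x` under the bijection `T`. -/
def orbitZ (T : ℝ → ℝ) (x : ℝ) : Set ℝ := {y | ∃ n : ℕ, T^[n] x = y ∨ T^[n] y = x}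

/-- `T` is minimal: every orbit is dense in `[0,1)`. -/
def IsMinimal (T : ℝ → ℝ) : Prop := ∀ x ∈ unitI, unitI ⊆ closure (orbitZ T x)

/-- `T` is of rotation type: `T x = x + α (mod 1)` on `[0,1)`. -/
def IsRotationType (T : ℝ → ℝ) : Prop := ∃ α : ℝ, ∀ x ∈ unitI, T x = Int.fract (x + α)

/-- `T` has an `n`-th root in the group `𝔾` of IETs for some `n ≥ 2`. -/
def HasNontrivialRoot (T : ℝ → ℝ) : Prop :=
  ∃ (S : ℝ → ℝ) (n : ℕ), IsIET S ∧ 2 ≤ n ∧ S^[n] = T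

/-- The set `D(T)` of points of `[0,1)` at which `T` is discontinuous
(as a map of `[0,1)`). -/
def DiscSet (T : ℝ → ℝ) : Set ℝ := {x | x ∈ unitI ∧ ¬ ContinuousWithinAt T unitI x}

/-- `β_j = λ_1 + ⋯ + λ_j` (`0`-indexed: the sum of the first `j` lengths). -/
def betaPt {m : ℕ} (lam : Fin m → ℝ) (j : ℕ) : ℝ :=
  ∑ i ∈ Finset.univ.filter (fun i : Fin m => (i : ℕ) < j), lam i

/-- The interval exchange transformation `T_{(π,λ)}` determined by a permutation
`π ∈ S_m` and a length vector `λ`: on `I_j = [β_{j-1}, β_j)` it is given by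
`x ↦ x - ∑_{i<j} λ_i + ∑_{π(i)<π(j)} λ_i`; outside `[0,1)` it is the identity. -/
noncomputable def ietMap {m : ℕ} (π : Equiv.Perm (Fin m)) (lam : Fin m → ℝ) : ℝ → ℝ :=
  fun x =>
    if h : ∃ j : Fin m, x ∈ Set.Ico (betaPt lam (j : ℕ)) (betaPt lam (j : ℕ) + lam j) then
      x - betaPt lam (h.choose : ℕ) +
        ∑ i ∈ Finset.univ.filter (fun i : Fin m => π i < π h.choose), lam i
    else x

/-- A permutation `π ∈ S_m` is separating if `π(i+1) ≠ π(i) + 1` for `1 ≤ i ≤ m-1`. -/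
def Separating {m : ℕ} (π : Equiv.Perm (Fin m)) : Prop :=
  ∀ i j : Fin m, (j : ℕ) = (i : ℕ) + 1 → (π j : ℕ) ≠ (π i : ℕ) + 1

/-- A permutation `π ∈ S_m` is irreducible if `π({1,…,k}) ≠ {1,…,k}` for all `k < m`. -/
def IrreduciblePerm {m : ℕ} (π : Equiv.Perm (Fin m)) : Prop :=
  ∀ k : ℕ, 1 ≤ k → k < m → ∃ i : Fin m, (i : ℕ) < k ∧ k ≤ (π i : ℕ)

/-- The endpoints `0 = γ_0 < γ_1 < ⋯ < γ_{m-1} < γ_m = 1`, namely the discontinuities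
of `T` together with `0` and `1`. -/
def endpointsOf (T : ℝ → ℝ) : Set ℝ := insert 0 (insert 1 (DiscSet T))

/-- The set of lengths `l_j = γ_j - γ_{j-1}` of the intervals of continuity of `T`,
i.e. the gaps between consecutive endpoints. -/
def gapLengths (T : ℝ → ℝ) : Set ℝ :=
  {l | ∃ a ∈ endpointsOf T, ∃ b ∈ endpointsOf T,
        a < b ∧ (∀ c ∈ endpointsOf T, ¬(a < c ∧ c < b)) ∧ l = b - a}

/-- The rank of `T`: the dimension of the `ℚ`-vector space spanned by the lengths
`l_1, …, l_m`. -/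
noncomputable def ietRank (T : ℝ → ℝ) : ℕ :=
  Module.finrank ℚ (Submodule.span ℚ (gapLengths T))

/-- Keane's infinite distinct orbit condition for an `m`-IET `T = T_{(π,λ)}`:
the orbits of `β_1, …, β_{m-1}` are infinite and pairwise disjoint. -/
def SatisfiesIDOC {m : ℕ} (lam : Fin m → ℝ) (T : ℝ → ℝ) : Prop :=
  (∀ j : ℕ, 1 ≤ j → j ≤ m - 1 → (orbitZ T (betaPt lam j)).Infinite) ∧
  ∀ j j' : ℕ, 1 ≤ j → j ≤ m - 1 → 1 ≤ j' → j' ≤ m - 1 → j ≠ j' →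
    orbitZ T (betaPt lam j) ∩ orbitZ T (betaPt lam j') = ∅

/-- A rotation: a `2`-IET with permutation `(21)`, i.e. `x ↦ x + α (mod 1)`
with `α ∈ (0,1)`. -/
def IsRotation (S : ℝ → ℝ) : Prop :=
  (∀ x, x ∉ unitI → S x = x) ∧ ∃ α ∈ Set.Ioo (0 : ℝ) 1, ∀ x ∈ unitI, S x = Int.fract (x + α)

/-- Conjugacy in the group `𝔾` of IETs. -/
def IsConjugate (T T' : ℝ → ℝ) : Prop := ∃ g : ℝ → ℝ, IsIET g ∧ g ∘ T = T' ∘ g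

/-- `T` is a tower of type `(n_1, …, n_k)` over the `k`-IET `S`:  there is a partition
`0 = t_0 < t_1 < ⋯ < t_k = 1` into intervals `I_i` on which `S` is a translation, a
scaling factor `c > 0`, and for each `i` a family of `n_i` pairwise disjoint "levels"
(scaled copies of `I_i`) which together partition `[0,1)`, such that `T` translates each
level of the `i`-th column onto the next one, and maps the top level back to the bottom
levels according to `S` (all after rescaling by `c`). -/
def IsTowerOver {k : ℕ} (T : ℝ → ℝ) (n : Fin k → ℕ) (S : ℝ → ℝ) : Prop :=
  IsIET T ∧ IsIET S ∧ (∀ i, 0 < n i) ∧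
  ∃ (t : Fin (k + 1) → ℝ) (c : ℝ) (a : Fin k → ℕ → ℝ),
    StrictMono t ∧ t 0 = 0 ∧ t (Fin.last k) = 1 ∧ 0 < c ∧
    (∀ i : Fin k, ∃ d : ℝ, ∀ x ∈ Set.Ico (t i.castSucc) (t i.succ), S x = x + d) ∧
    (∀ i : Fin k, ∀ j : ℕ, j < n i →
      Set.Ico (a i j) (a i j + c * (t i.succ - t i.castSucc)) ⊆ unitI) ∧
    (∀ i i' : Fin k, ∀ j j' : ℕ, j < n i → j' < n i' → (i, j) ≠ (i', j') →
      Disjoint (Set.Ico (a i j) (a i j + c * (t i.succ - t i.castSucc)))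
        (Set.Ico (a i' j') (a i' j' + c * (t i'.succ - t i'.castSucc)))) ∧
    (∀ y ∈ unitI, ∃ (i : Fin k) (j : ℕ), j < n i ∧
      y ∈ Set.Ico (a i j) (a i j + c * (t i.succ - t i.castSucc))) ∧
    (∀ i : Fin k, ∀ j : ℕ, j + 1 < n i → ∀ x ∈ Set.Ico (t i.castSucc) (t i.succ),
      T (a i j + c * (x - t i.castSucc)) = a i (j + 1) + c * (x - t i.castSucc)) ∧
    (∀ i : Fin k, ∀ x ∈ Set.Ico (t i.castSucc) (t i.succ), ∀ i' : Fin k,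
      S x ∈ Set.Ico (t i'.castSucc) (t i'.succ) →
      T (a i (n i - 1) + c * (x - t i.castSucc)) = a i' 0 + c * (S x - t i'.castSucc))

/-- The data of the first return map of `T` to `J = [a,b)`: a partition
`a = s_0 < s_1 < ⋯ < s_k = b` of `J`, return times `mt_i ≥ 1` and translation
constants `c_i` such that for `x` in the `i`-th piece the iterates `T^j x`, `0 < j < mt_i`,
avoid `J`, while `T^{mt_i} x = x + c_i ∈ J`.  Thus the first return map `T_J` is the
`k`-IET `x ↦ x + c_i` on the `i`-th piece. -/
def IsFirstReturnSystem (T : ℝ → ℝ) (a b : ℝ) {k : ℕ} (s : Fin (k + 1) → ℝ)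
    (mt : Fin k → ℕ) (c : Fin k → ℝ) : Prop :=
  StrictMono s ∧ s 0 = a ∧ s (Fin.last k) = b ∧
  ∀ i : Fin k, 0 < mt i ∧ ∀ x ∈ Set.Ico (s i.castSucc) (s i.succ),
    (∀ j : ℕ, 0 < j → j < mt i → T^[j] x ∉ Set.Ico a b) ∧
    T^[mt i] x ∈ Set.Ico a b ∧ T^[mt i] x = x + c i

/-- A finite sequence `x_0, …, x_k` is an `S`-chain if `x_0` and `x_k` lie in
`D(S) ∪ {0}` and `S x_i = x_{i+1}`. -/
def IsSChainSeq (S : ℝ → ℝ) {k : ℕ} (x : Fin (k + 1) → ℝ) : Prop :=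
  x 0 ∈ insert (0 : ℝ) (DiscSet S) ∧ x (Fin.last k) ∈ insert (0 : ℝ) (DiscSet S) ∧
  ∀ i : Fin k, S (x i.castSucc) = x i.succ

/-- A set `C ⊆ ℝ` is (the underlying set of) an `S`-chain. -/
def IsSChain (S : ℝ → ℝ) (C : Set ℝ) : Prop :=
  ∃ (k : ℕ) (x : Fin (k + 1) → ℝ), IsSChainSeq S x ∧ C = Set.range x

/-- A maximal `S`-chain: an `S`-chain which is not a proper subset of another `S`-chain. -/
def IsMaximalSChain (S : ℝ → ℝ) (C : Set ℝ) : Prop :=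
  IsSChain S C ∧ ∀ C', IsSChain S C' → C ⊆ C' → C = C'

/-- The open simplex `Δ_m ⊆ ℝ^m`. -/
def simplexSet (m : ℕ) : Set (Fin m → ℝ) := {lam | (∀ i, 0 < lam i) ∧ ∑ i, lam i = 1}

/-- The affine chart identifying (a superset of) `Δ_m` with a subset of `ℝ^{m-1}`:
`λ_i = x_i` for `i < m-1` and `λ_{m-1} = 1 - ∑ x_j`.  Lebesgue measure on `Δ_m`
is the `(m-1)`-dimensional Lebesgue measure carried through this chart. -/
def chartMap (m : ℕ) (x : Fin (m - 1) → ℝ) : Fin m → ℝ := fun i =>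
  if h : (i : ℕ) < m - 1 then x ⟨(i : ℕ), h⟩ else 1 - ∑ j, x j

/-- The permutation `(321) ∈ S_3`, sending `1 ↦ 3`, `2 ↦ 2`, `3 ↦ 1`. -/
def perm321 : Equiv.Perm (Fin 3) :=
  ⟨fun i => i.rev, fun i => i.rev, fun i => Fin.rev_rev i, fun i => Fin.rev_rev i⟩

end


theorem iet_cases (lam : Fin 3 → ℝ) (hpos : ∀ i, 0 < lam i) (hsum : ∑ i, lam i = 1) (x : ℝ) :
    (0 ≤ x ∧ x < lam 0 ∧ ietMap perm321 lam x = x + (1 - lam 0)) ∨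
    (lam 0 ≤ x ∧ x < lam 0 + lam 1 ∧
      ietMap perm321 lam x = x + (1 - lam 0) - (1 - lam 2)) ∨
    (lam 0 + lam 1 ≤ x ∧ x < 1 ∧ ietMap perm321 lam x = x - (1 - lam 2)) ∨
    (x ∉ unitI ∧ ietMap perm321 lam x = x) := by
  have h0 := hpos 0
  have h1 := hpos 1
  have h2 := hpos 2
  rw [Fin.sum_univ_three] at hsum
  have b0 : betaPt lam 0 = 0 := by simp [betaPt]
  have b1 : betaPt lam 1 = lam 0 := by
    simp [betaPt, Finset.sum_filter, Fin.sum_univ_three]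
  have b2 : betaPt lam 2 = lam 0 + lam 1 := by
    simp [betaPt, Finset.sum_filter, Fin.sum_univ_three]
  by_cases h : ∃ j : Fin 3, x ∈ Set.Ico (betaPt lam (j : ℕ)) (betaPt lam (j : ℕ) + lam j)
  · have e : ietMap perm321 lam x = x - betaPt lam (h.choose : ℕ) +
        ∑ i ∈ Finset.univ.filter (fun i : Fin 3 => perm321 i < perm321 h.choose), lam i := by
      unfold ietMap
      rw [dif_pos h]
    have hs := h.choose_spec
    rw [e]
    generalize h.choose = j at hs
    have r0 : perm321 0 = 2 := rfl
    have r1 : perm321 1 = 1 := rfl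
    have r2 : perm321 2 = 0 := rfl
    fin_cases j
    · left
      simp [b0] at hs
      refine ⟨hs.1, hs.2, ?_⟩
      simp [b0, Finset.sum_filter, Fin.sum_univ_three, r0, r1, r2]
      linarith
    · right; left
      simp [b1] at hs
      refine ⟨hs.1, hs.2, ?_⟩
      simp [b1, Finset.sum_filter, Fin.sum_univ_three, r0, r1, r2]
      linarith
    · right; right; left
      simp [b2] at hs
      refine ⟨hs.1, by linarith, ?_⟩
      simp [b2, Finset.sum_filter, Fin.sum_univ_three, r0, r1, r2]
      linarith
  · right; right; right
    refine ⟨?_, by unfold ietMap; rw [dif_neg h]⟩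
    rintro ⟨hx0, hx1⟩
    apply h
    rcases lt_or_ge x (lam 0) with c0 | c0
    · exact ⟨0, by simp [b0, hx0, c0]⟩
    rcases lt_or_ge x (lam 0 + lam 1) with c1 | c1
    · exact ⟨1, by simp [b1, c0, c1]⟩
    · exact ⟨2, by simp [b2, c1]; linarith⟩

theorem step_mem (lam : Fin 3 → ℝ) (hpos : ∀ i, 0 < lam i) (hsum : ∑ i, lam i = 1) (x : ℝ) :
    ∃ m k : ℤ, ietMap perm321 lam x = x + m * (1 - lam 0) + k * (1 - lam 2) := by
  rcases iet_cases lam hpos hsum x with ⟨-, -, h⟩ | ⟨-, -, h⟩ | ⟨-, -, h⟩ | ⟨-, h⟩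
  · exact ⟨1, 0, by rw [h]; simp⟩
  · exact ⟨1, -1, by rw [h]; simp; ring⟩
  · exact ⟨0, -1, by rw [h]; simp; ring⟩
  · exact ⟨0, 0, by rw [h]; simp⟩

theorem iter_mem (lam : Fin 3 → ℝ) (hpos : ∀ i, 0 < lam i) (hsum : ∑ i, lam i = 1) (n : ℕ) :
    ∀ x : ℝ, ∃ m k : ℤ,
      (ietMap perm321 lam)^[n] x = x + m * (1 - lam 0) + k * (1 - lam 2) := by
  induction n with
  | zero => intro x; exact ⟨0, 0, by simp⟩
  | succ n ih =>
    intro x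
    obtain ⟨m, k, h⟩ := step_mem lam hpos hsum x
    obtain ⟨m', k', h'⟩ := ih (ietMap perm321 lam x)
    refine ⟨m + m', k + k', ?_⟩
    rw [Function.iterate_succ_apply, h', h]
    push_cast
    ring

/-- The map is the first return map to `[0,1)` of the rotation by `1 - lam 0` on the circle
of length `(1 - lam 0) + (1 - lam 2)`. -/
theorem reach (lam : Fin 3 → ℝ) (hpos : ∀ i, 0 < lam i) (hsum : ∑ i, lam i = 1) (n : ℕ) :
    ∀ x ∈ unitI, ∀ z ∈ unitI, ∀ k : ℤ,
      z = x + n * (1 - lam 0) + k * ((1 - lam 0) + (1 - lam 2)) →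
      ∃ j : ℕ, (ietMap perm321 lam)^[j] x = z := by
  have h0 := hpos 0
  have h1 := hpos 1
  have h2 := hpos 2
  have hs := hsum
  rw [Fin.sum_univ_three] at hs
  induction n using Nat.strong_induction_on with
  | _ n ih =>
    intro x hx z hz k hzk
    obtain ⟨hx0, hx1⟩ := id hx
    obtain ⟨hz0, hz1⟩ := id hz
    rcases n with _ | n
    · have hk : k = 0 := by
        rcases lt_trichotomy k 0 with hk | hk | hk
        · have : (k : ℝ) ≤ -1 := by exact_mod_cast (by omega : k ≤ -1)
          exfalso; push_cast at hzk; nlinarith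
        · exact hk
        · have : (1 : ℝ) ≤ k := by exact_mod_cast (by omega : 1 ≤ k)
          exfalso; push_cast at hzk; nlinarith
      exact ⟨0, by simp [hzk, hk]⟩
    rcases iet_cases lam hpos hsum x with ⟨c, d, h⟩ | ⟨c, d, h⟩ | ⟨c, d, h⟩ | ⟨c, h⟩
    · obtain ⟨j, hj⟩ := ih n (by omega) (ietMap perm321 lam x)
        (by rw [h]; constructor <;> linarith) z hz k (by rw [h, hzk]; push_cast; ring)
      exact ⟨j + 1, by rw [Function.iterate_succ_apply, hj]⟩
    · rcases n with _ | n
      · exfalso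
        rcases lt_or_ge k 0 with hk | hk
        · have : (k : ℝ) ≤ -1 := by exact_mod_cast (by omega : k ≤ -1)
          push_cast at hzk; nlinarith
        · have : (0 : ℝ) ≤ k := by exact_mod_cast hk
          push_cast at hzk; nlinarith
      · obtain ⟨j, hj⟩ := ih n (by omega) (ietMap perm321 lam x)
          (by rw [h]; constructor <;> linarith) z hz (k + 1) (by rw [h, hzk]; push_cast; ring)
        exact ⟨j + 1, by rw [Function.iterate_succ_apply, hj]⟩
    · obtain ⟨j, hj⟩ := ih n (by omega) (ietMap perm321 lam x)
        (by rw [h]; constructor <;> linarith) z hz (k + 1) (by rw [h, hzk]; push_cast; ring)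
      exact ⟨j + 1, by rw [Function.iterate_succ_apply, hj]⟩
    · exact absurd hx c

theorem irr_equiv (u v : ℝ) (hv : 0 < v) : Irrational ((v - u) / v) ↔ Irrational (u / v) := by
  have : (v - u) / v = ((1 : ℤ) : ℝ) - u / v := by field_simp; simp
  rw [this, irrational_intCast_sub_iff]

theorem stmt18 (lam : Fin 3 → ℝ) (hpos : ∀ i, 0 < lam i) (hsum : ∑ i, lam i = 1) :
    IsMinimal (ietMap perm321 lam) ↔ Irrational ((lam 0 - lam 2) / (1 - lam 2)) := by
  have h0 := hpos 0
  have h1 := hpos 1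
  have h2 := hpos 2
  have hs := hsum
  rw [Fin.sum_univ_three] at hs
  have hu : 0 < 1 - lam 0 := by linarith
  have hv : 0 < 1 - lam 2 := by linarith
  have e1 : lam 0 - lam 2 = (1 - lam 2) - (1 - lam 0) := by ring
  rw [e1, irr_equiv _ _ hv, ← dense_addSubgroupClosure_pair_iff]
  constructor
  · intro hmin
    by_contra hd
    obtain ⟨d, hd'⟩ := (AddSubgroup.dense_or_cyclic
      (AddSubgroup.closure {1 - lam 0, 1 - lam 2})).resolve_left hd
    rw [← AddSubgroup.zmultiples_eq_closure] at hd'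
    have hsub : orbitZ (ietMap perm321 lam) 0 ⊆
        (AddSubgroup.closure {1 - lam 0, 1 - lam 2} : AddSubgroup ℝ) := by
      rintro y ⟨n, hy | hy⟩
      · obtain ⟨m, k, h⟩ := iter_mem lam hpos hsum n 0
        rw [SetLike.mem_coe, AddSubgroup.mem_closure_pair]
        exact ⟨m, k, by rw [← hy, h]; simp⟩
      · obtain ⟨m, k, h⟩ := iter_mem lam hpos hsum n y
        rw [SetLike.mem_coe, AddSubgroup.mem_closure_pair]
        refine ⟨-m, -k, ?_⟩
        rw [hy] at h
        simp only [zsmul_eq_mul]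
        push_cast
        linarith
    rw [hd'] at hsub
    have hcl : IsClosed ((AddSubgroup.zmultiples d : AddSubgroup ℝ) : Set ℝ) :=
      AddSubgroup.isClosed_of_discrete
    have hall := (hmin 0 ⟨le_refl _, one_pos⟩).trans (closure_minimal hsub hcl)
    have hcount : (unitI).Countable := by
      refine Set.Countable.mono hall ?_
      rw [AddSubgroup.coe_zmultiples]
      exact Set.countable_range _
    exact (Cardinal.Real.Ico_countable_iff.1 hcount).not_gt one_pos
  · intro hd x hx y hy
    rw [Metric.mem_closure_iff]
    intro ε hε
    have hy' : y < min (y + ε) 1 := lt_min (by linarith) hy.2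
    obtain ⟨w, hw, hwm⟩ := hd.exists_mem_open (isOpen_Ioo (a := y - x) (b := min (y + ε) 1 - x))
      (nonempty_Ioo.2 (by linarith))
    rw [SetLike.mem_coe, AddSubgroup.mem_closure_pair] at hw
    obtain ⟨m, k, hmk⟩ := hw
    simp only [zsmul_eq_mul] at hmk
    have l1 := min_le_left (y + ε) 1
    have l2 := min_le_right (y + ε) 1
    have hz : x + w ∈ unitI := ⟨by linarith [hwm.1, hy.1], by linarith [hwm.2]⟩
    refine ⟨x + w, ?_, by rw [Real.dist_eq, abs_lt]; constructor <;> linarith [hwm.1, hwm.2]⟩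
    rcases le_total k m with hkm | hkm
    · obtain ⟨n, hn⟩ := Int.eq_ofNat_of_zero_le (sub_nonneg.2 hkm)
      have hn' : (m : ℝ) - k = n := by exact_mod_cast hn
      obtain ⟨j, hj⟩ := reach lam hpos hsum n x hx (x + w) hz k
        (by rw [← hmk, ← hn']; ring)
      exact ⟨j, Or.inl hj⟩
    · obtain ⟨n, hn⟩ := Int.eq_ofNat_of_zero_le (sub_nonneg.2 hkm)
      have hn' : (k : ℝ) - m = n := by exact_mod_cast hn
      obtain ⟨j, hj⟩ := reach lam hpos hsum n (x + w) hz x hx (-k)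
        (by rw [← hmk, ← hn']; push_cast; ring)
      exact ⟨j, Or.inr hj⟩

end IETRoots
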